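/- arXiv:1805.07724 — 5 statements merged into one kernel-verified Lean document; each statement's English description precedes it below -/
import Mathlib

section
/- Let n ≥ 1, let c : Fin n → ℝ be a finite family of centers, and let r > 0. Let U = ⋃_i [c i − r, c i + r] be the union of the closed balls of radius r around the centers. Then U is a preconnected subset of ℝ if and only if the closed interval [(min_i c i) − r, (max_i c i) + r] is contained in U (equivalently, U equals this interval). -/
/-- A union of closed balls of equal radius `r > 0` around finitely many centers
on the real line is preconnected iff it contains (equivalently, equals) the
closed interval from `min center − r` to `max center + r`. -/
theorem stmt4 (n : ℕ) (hn : 1 ≤ n) (c : Fin n → ℝ) (r : ℝ) (hr : 0 < r) :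
    IsPreconnected (⋃ i, Set.Icc (c i - r) (c i + r)) ↔
      Set.Icc
          (Finset.univ.inf' ⟨(⟨0, hn⟩ : Fin n), Finset.mem_univ _⟩ c - r)
          (Finset.univ.sup' ⟨(⟨0, hn⟩ : Fin n), Finset.mem_univ _⟩ c + r) ⊆
        ⋃ i, Set.Icc (c i - r) (c i + r) := by
  constructor
  · intro h
    obtain ⟨i, -, hi⟩ := Finset.exists_mem_eq_inf' (s := Finset.univ)
      ⟨(⟨0, hn⟩ : Fin n), Finset.mem_univ _⟩ c
    obtain ⟨j, -, hj⟩ := Finset.exists_mem_eq_sup' (s := Finset.univ)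
      ⟨(⟨0, hn⟩ : Fin n), Finset.mem_univ _⟩ c
    rw [hi, hj]
    exact h.Icc_subset
      (Set.mem_iUnion.2 ⟨i, Set.mem_Icc.2 ⟨le_refl _, by linarith⟩⟩)
      (Set.mem_iUnion.2 ⟨j, Set.mem_Icc.2 ⟨by linarith, le_refl _⟩⟩)
  · intro h
    rw [Set.Subset.antisymm (Set.iUnion_subset fun i => Set.Icc_subset_Icc
      (sub_le_sub_right (Finset.inf'_le c (Finset.mem_univ i)) r)
      (add_le_add_left (Finset.le_sup' c (Finset.mem_univ i)) r)) h]
    exact isPreconnected_Icc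
end

section
/- Let n > 0 be a real number, let N ≥ 1 and f ≥ 1 be natural numbers, and let a, b, a', b' : Fin N → ℝ satisfy 0 ≤ a i ≤ b i ≤ n and 0 ≤ a' i ≤ b' i ≤ n for all i (a family of N pairs of closed intervals contained in [0,n]). Consider the f-fold copied family indexed by Fin f × Fin N, whose (j,i)-th pair consists of the translated intervals [a i + j·n, b i + j·n] and [a' i + j·n, b' i + j·n]. If there exist a choice c : Fin f × Fin N → Bool and real numbers u ≤ v with v − u > 2·n such that [u,v] is contained in the union over (j,i) of the intervals chosen by c, then there exists a choice c₀ : Fin N → Bool such that [0,n] is contained in the union over i of the intervals of the original family chosen by c₀. -/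
/-- Correctness of the copying construction in the proof of Theorem 5: if the
`f`-fold translated copies of a family of interval pairs contained in `[0,n]`
admit a choice covering a contiguous interval of length greater than `2n`, then
the original family admits a choice covering `[0,n]`. -/
theorem stmt8 (n : ℝ) (hn : 0 < n) (N f : ℕ) (hN : 1 ≤ N) (hf : 1 ≤ f)
    (a b a' b' : Fin N → ℝ)
    (hab : ∀ i, 0 ≤ a i ∧ a i ≤ b i ∧ b i ≤ n)
    (hab' : ∀ i, 0 ≤ a' i ∧ a' i ≤ b' i ∧ b' i ≤ n)
    (c : Fin f × Fin N → Bool) (u v : ℝ) (huv : u ≤ v) (hlen : 2 * n < v - u)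
    (hcov : Set.Icc u v ⊆ ⋃ p : Fin f × Fin N,
      if c p then
        Set.Icc (a p.2 + ((p.1 : ℕ) : ℝ) * n) (b p.2 + ((p.1 : ℕ) : ℝ) * n)
      else
        Set.Icc (a' p.2 + ((p.1 : ℕ) : ℝ) * n)
          (b' p.2 + ((p.1 : ℕ) : ℝ) * n)) :
    ∃ c₀ : Fin N → Bool, Set.Icc (0 : ℝ) n ⊆
      ⋃ i, if c₀ i then Set.Icc (a i) (b i) else Set.Icc (a' i) (b' i) := by
  have key : ∀ (m : ℤ) (x : ℝ), u ≤ m * n → (m + 1) * n ≤ v → 0 < x → x < n →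
      ∃ p : Fin f × Fin N, ((p.1 : ℕ) : ℤ) = m ∧
        x ∈ (if c p then Set.Icc (a p.2) (b p.2) else Set.Icc (a' p.2) (b' p.2)) := by
    intro m x hu hv hx0 hxn
    have hmem : x + m * n ∈ Set.Icc u v := ⟨by linarith, by linarith⟩
    obtain ⟨p, hp⟩ := Set.mem_iUnion.1 (hcov hmem)
    have h1 := hab p.2
    have h2 := hab' p.2
    have hb : ((p.1 : ℕ) : ℝ) * n ≤ x + m * n ∧ x + m * n ≤ n + ((p.1 : ℕ) : ℝ) * n := by
      split_ifs at hp
      · exact ⟨by linarith [hp.1], by linarith [hp.2]⟩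
      · exact ⟨by linarith [hp.1], by linarith [hp.2]⟩
    have hk : ((p.1 : ℕ) : ℤ) = m := by
      have e1 : (((p.1 : ℕ) : ℤ) : ℝ) < ((m + 1 : ℤ) : ℝ) := by
        push_cast
        refine lt_of_mul_lt_mul_right ?_ hn.le
        linarith [hb.1]
      have e2 : (m : ℝ) < ((((p.1 : ℕ) : ℤ) + 1 : ℤ) : ℝ) := by
        push_cast
        refine lt_of_mul_lt_mul_right ?_ hn.le
        linarith [hb.2]
      have e1' := Int.cast_lt.1 e1
      have e2' := Int.cast_lt.1 e2
      omega
    have hkr : ((p.1 : ℕ) : ℝ) = m := by exact_mod_cast hk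
    refine ⟨p, hk, ?_⟩
    rw [hkr] at hp
    split_ifs at hp ⊢
    · exact ⟨by linarith [hp.1], by linarith [hp.2]⟩
    · exact ⟨by linarith [hp.1], by linarith [hp.2]⟩
  have hu : u ≤ (⌈u / n⌉ : ℝ) * n := (div_le_iff₀ hn).1 (Int.le_ceil _)
  have hv : ((⌈u / n⌉ : ℝ) + 1) * n ≤ v := by
    have h := mul_lt_mul_of_pos_right (Int.ceil_lt_add_one (u / n)) hn
    have h' : (u / n + 1) * n = u + n := by field_simp
    linarith
  obtain ⟨p₀, hp₀, -⟩ := key _ (n / 2) hu hv (by linarith) (by linarith)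
  refine ⟨fun i => c (p₀.1, i), ?_⟩
  have hcl : IsClosed (⋃ i, if c (p₀.1, i) then Set.Icc (a i) (b i)
      else Set.Icc (a' i) (b' i)) := by
    refine isClosed_iUnion_of_finite fun i => ?_
    split_ifs <;> exact isClosed_Icc
  rw [← closure_Ioo hn.ne]
  refine closure_minimal ?_ hcl
  intro x hx
  obtain ⟨⟨j, i⟩, hp, hxp⟩ := key _ x hu hv hx.1 hx.2
  have hj : j = p₀.1 := by
    apply Fin.ext
    have := hp.trans hp₀.symm
    exact_mod_cast this
  subst hj
  exact Set.mem_iUnion.2 ⟨i, hxp⟩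
end

section
/- For every natural number N and every family of N pairs of closed subintervals of [0,1] (given by endpoint functions a, b, a', b' : Fin N → ℝ with 0 ≤ a i ≤ b i ≤ 1 and 0 ≤ a' i ≤ b' i ≤ 1), there exist a natural number s and a CNF formula C : Fin s → Finset (Fin N × Bool) that is contiguous, such that for every c : Fin N → Bool: the interval [0,1] is contained in ⋃_i J_i(c) if and only if c satisfies C. Here J_i(c) = [a i, b i] if c i = true and J_i(c) = [a' i, b' i] if c i = false. -/
/-- From a SEGMENT COVER instance one constructs a contiguous CNF formula whose
satisfying assignments are exactly the covering choices. -/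
theorem stmt9 (N : ℕ) (a b a' b' : Fin N → ℝ)
    (hab : ∀ i, 0 ≤ a i ∧ a i ≤ b i ∧ b i ≤ 1)
    (hab' : ∀ i, 0 ≤ a' i ∧ a' i ≤ b' i ∧ b' i ≤ 1) :
    ∃ (s : ℕ) (C : Fin s → Finset (Fin N × Bool)),
      (∀ (l : Fin N × Bool) (j₁ j₂ j : Fin s),
        l ∈ C j₁ → l ∈ C j₂ → j₁ ≤ j → j ≤ j₂ → l ∈ C j) ∧
      (∀ c : Fin N → Bool,
        (Set.Icc (0:ℝ) 1 ⊆
            ⋃ i, if c i then Set.Icc (a i) (b i) else Set.Icc (a' i) (b' i)) ↔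
          (∀ j, ∃ l ∈ C j, c l.1 = l.2)) := by
  classical
  let J : Fin N × Bool → Set ℝ := fun l =>
    if l.2 then Set.Icc (a l.1) (b l.1) else Set.Icc (a' l.1) (b' l.1)
  have hJ : ∀ l x y z, x ∈ J l → z ∈ J l → x ≤ y → y ≤ z → y ∈ J l := by
    rintro ⟨i, t⟩ x y z hx hz hxy hyz
    cases t
    · simp only [J, Bool.false_eq_true, if_false, Set.mem_Icc] at *
      exact ⟨hx.1.trans hxy, hyz.trans hz.2⟩
    · simp only [J, if_true, Set.mem_Icc] at *
      exact ⟨hx.1.trans hxy, hyz.trans hz.2⟩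
  let T : ℝ → Finset (Fin N × Bool) := fun x => Finset.univ.filter (fun l => x ∈ J l)
  have hT : ∀ x l, l ∈ T x ↔ x ∈ J l := by intro x l; simp [T]
  obtain ⟨S, hS, hbij⟩ := Set.exists_subset_bijOn (Set.Icc (0:ℝ) 1) T
  have hfin : S.Finite := Set.Finite.of_finite_image (Set.toFinite _) hbij.injOn
  let P := hfin.toFinset
  let e := P.orderEmbOfFin rfl
  refine ⟨P.card, fun j => T (e j), ?_, ?_⟩
  · intro l j₁ j₂ j h1 h2 h3 h4
    rw [hT] at *
    exact hJ l _ _ _ h1 h2 (e.monotone h3) (e.monotone h4)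
  · intro c
    have key : ∀ x, (x ∈ ⋃ i, if c i then Set.Icc (a i) (b i) else Set.Icc (a' i) (b' i)) ↔
        ∃ l ∈ T x, c l.1 = l.2 := by
      intro x
      rw [Set.mem_iUnion]
      constructor
      · rintro ⟨i, hi⟩
        exact ⟨(i, c i), (hT _ _).2 hi, rfl⟩
      · rintro ⟨⟨i, t⟩, hl, h⟩
        refine ⟨i, ?_⟩
        have h' : c i = t := h
        subst h'
        exact (hT _ _).1 hl
    constructor
    · intro h j
      refine (key _).1 (h (hS ?_))
      exact hfin.mem_toFinset.1 (P.orderEmbOfFin_mem rfl j)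
    · intro h x hx
      rw [key]
      obtain ⟨y, hy, hyx⟩ := hbij.surjOn (Set.mem_image_of_mem T hx)
      have hyr : y ∈ Set.range e := by
        rw [Finset.range_orderEmbOfFin]
        exact hfin.mem_toFinset.2 hy
      obtain ⟨j, rfl⟩ := hyr
      rw [← hyx]
      exact h j
end

section
/- For every contiguous CNF formula C : Fin s → Finset (Fin n × Bool) with s ≥ 1 clauses and n variables, there exists a family of n pairs of closed subintervals of [0,1] (given by endpoint functions a, b, a', b' : Fin n → ℝ, where an interval may be empty) such that for every assignment c : Fin n → Bool: c satisfies C if and only if [0,1] ⊆ ⋃_v J_v(c), where J_v(c) = [a v, b v] if c v = true and J_v(c) = [a' v, b' v] if c v = false. -/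
theorem seg_aux (s : ℕ) (hs : 1 ≤ s) (P : Fin s → Prop)
    (hP : ∀ j₁ j₂ j : Fin s, P j₁ → P j₂ → j₁ ≤ j → j ≤ j₂ → P j) :
    ∃ a b : ℝ, Set.Icc a b ⊆ Set.Icc (0:ℝ) 1 ∧
      (∀ j : Fin s, P j → ∀ x : ℝ, (j:ℝ) ≤ x * s → x * s ≤ j + 1 → x ∈ Set.Icc a b) ∧
      (∀ j : Fin s, ((j:ℝ) + 1/2) / s ∈ Set.Icc a b → P j) := by
  classical
  have hs0 : (0:ℝ) < s := by exact_mod_cast hs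
  by_cases hne : ∃ j, P j
  · obtain ⟨j0, hj0⟩ := hne
    have hne : (Finset.univ.filter P).Nonempty := ⟨j0, by simp [hj0]⟩
    obtain ⟨p, hp, hpm⟩ := Finset.exists_min_image _ id hne
    obtain ⟨q, hq, hqm⟩ := Finset.exists_max_image _ id hne
    simp only [Finset.mem_filter, Finset.mem_univ, true_and, id] at hp hpm hq hqm
    refine ⟨(p:ℝ) / s, ((q:ℝ) + 1) / s, ?_, ?_, ?_⟩
    · apply Set.Icc_subset_Icc
      · positivity
      · rw [div_le_one hs0]
        exact_mod_cast q.2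
    · intro j hj x h1 h2
      have e1 : ((p:ℕ):ℝ) ≤ (j:ℕ) := by exact_mod_cast hpm j hj
      have e2 : ((j:ℕ):ℝ) ≤ (q:ℕ) := by exact_mod_cast hqm j hj
      constructor
      · rw [div_le_iff₀ hs0]; linarith
      · rw [le_div_iff₀ hs0]; linarith
    · rintro j ⟨h1, h2⟩
      rw [div_le_div_iff_of_pos_right hs0] at h1 h2
      refine hP p q j hp hq ?_ ?_
      · have : ((p:ℕ):ℝ) < ((j:ℕ) + 1 : ℕ) := by push_cast; linarith
        have : (p:ℕ) < (j:ℕ) + 1 := by exact_mod_cast this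
        exact Fin.le_def.2 (by omega)
      · have : ((j:ℕ):ℝ) < ((q:ℕ) + 1 : ℕ) := by push_cast; linarith
        have : (j:ℕ) < (q:ℕ) + 1 := by exact_mod_cast this
        exact Fin.le_def.2 (by omega)
  · refine ⟨1, 0, by simp, fun j hj => (hne ⟨j, hj⟩).elim, ?_⟩
    intro j hj
    simp at hj

theorem seg_block (s : ℕ) (hs : 1 ≤ s) (x : ℝ) (h0 : 0 ≤ x) (h1 : x ≤ 1) :
    ∃ j : Fin s, (j:ℝ) ≤ x * s ∧ x * s ≤ j + 1 := by
  have hs0 : (0:ℝ) < s := by exact_mod_cast hs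
  have hx : 0 ≤ x * s := by positivity
  by_cases h : ⌊x * s⌋₊ < s
  · exact ⟨⟨_, h⟩, Nat.floor_le hx, (Nat.lt_floor_add_one _).le⟩
  · have h2 : (s:ℝ) ≤ x * s := (Nat.le_floor_iff hx).1 (not_lt.1 h)
    refine ⟨⟨s - 1, by omega⟩, ?_, ?_⟩
    all_goals simp only [Nat.cast_sub hs, Nat.cast_one]
    · linarith
    · nlinarith

/-- From a contiguous CNF formula one constructs a SEGMENT COVER instance (one
pair of closed subintervals of `[0,1]`, possibly empty, per variable) whose
covering choices are exactly the satisfying assignments. -/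
theorem stmt10 (s n : ℕ) (hs : 1 ≤ s) (C : Fin s → Finset (Fin n × Bool))
    (hcontig : ∀ (l : Fin n × Bool) (j₁ j₂ j : Fin s),
      l ∈ C j₁ → l ∈ C j₂ → j₁ ≤ j → j ≤ j₂ → l ∈ C j) :
    ∃ a b a' b' : Fin n → ℝ,
      (∀ v, Set.Icc (a v) (b v) ⊆ Set.Icc (0:ℝ) 1) ∧
      (∀ v, Set.Icc (a' v) (b' v) ⊆ Set.Icc (0:ℝ) 1) ∧
      (∀ c : Fin n → Bool,
        (∀ j, ∃ l ∈ C j, c l.1 = l.2) ↔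
          Set.Icc (0:ℝ) 1 ⊆
            ⋃ v, if c v then Set.Icc (a v) (b v) else Set.Icc (a' v) (b' v)) := by
  have hs0 : (0:ℝ) < s := by exact_mod_cast hs
  choose A B hsub hin hout using fun l : Fin n × Bool =>
    seg_aux s hs (fun j => l ∈ C j) (hcontig l)
  have key : ∀ (c : Fin n → Bool) (v : Fin n),
      (if c v then Set.Icc (A (v, true)) (B (v, true))
        else Set.Icc (A (v, false)) (B (v, false))) = Set.Icc (A (v, c v)) (B (v, c v)) := by
    intro c v
    cases c v <;> simp
  refine ⟨fun v => A (v, true), fun v => B (v, true), fun v => A (v, false),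
    fun v => B (v, false), fun v => hsub _, fun v => hsub _, fun c => ?_⟩
  simp only [key]
  constructor
  · rintro h x ⟨hx0, hx1⟩
    obtain ⟨j, hj1, hj2⟩ := seg_block s hs x hx0 hx1
    obtain ⟨⟨v, t⟩, hl, hc⟩ := h j
    simp only at hc
    subst hc
    exact Set.mem_iUnion.2 ⟨v, hin _ j hl x hj1 hj2⟩
  · intro h j
    have hm : ((j:ℝ) + 1/2) / s ∈ Set.Icc (0:ℝ) 1 := by
      constructor
      · positivity
      · rw [div_le_one hs0]
        have : ((j:ℕ):ℝ) + 1 ≤ s := by exact_mod_cast j.2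
        linarith
    obtain ⟨v, hv⟩ := Set.mem_iUnion.1 (h hm)
    exact ⟨(v, c v), hout _ j hv, rfl⟩
end

section
/- For every natural number N and every family of N pairs of closed subintervals of [0,1] (given by endpoint functions a, b, a', b' : Fin N → ℝ with 0 ≤ a i ≤ b i ≤ 1 and 0 ≤ a' i ≤ b' i ≤ 1), there exist a natural number s, a CNF formula C : Fin s → Finset (Fin N × Bool), and nonnegative weights w : Fin s → ℝ such that for every choice c : Fin N → Bool, the Lebesgue measure of ⋃_i J_i(c) equals the sum of w j over all clauses j that contain some literal (i,t) with c i = t. Here J_i(c) = [a i, b i] if c i = true and J_i(c) = [a' i, b' i] if c i = false. -/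
/-- The elementary piece of points covered by exactly the literals in `S`. -/
def piece {N : ℕ} (I : Fin N × Bool → Set ℝ) (S : Finset (Fin N × Bool)) : Set ℝ :=
  {x | ∀ l, l ∈ S ↔ x ∈ I l}

theorem piece_measurable {N : ℕ} (I : Fin N × Bool → Set ℝ) (hI : ∀ l, MeasurableSet (I l))
    (S : Finset (Fin N × Bool)) : MeasurableSet (piece I S) := by
  have : piece I S = ⋂ l, (if l ∈ S then I l else (I l)ᶜ) := by
    ext x
    simp only [piece, Set.mem_setOf_eq, Set.mem_iInter]
    refine forall_congr' fun l => ?_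
    by_cases h : l ∈ S <;> simp [h]
  rw [this]
  refine MeasurableSet.iInter fun l => ?_
  split_ifs
  · exact hI l
  · exact (hI l).compl

/-- The weighted-SAT correspondence for MAX-SC: from a family of interval pairs
in `[0,1]` one constructs a weighted CNF formula such that, for every choice,
the covered measure equals the total weight of satisfied clauses. -/
theorem stmt11 (N : ℕ) (a b a' b' : Fin N → ℝ)
    (hab : ∀ i, 0 ≤ a i ∧ a i ≤ b i ∧ b i ≤ 1)
    (hab' : ∀ i, 0 ≤ a' i ∧ a' i ≤ b' i ∧ b' i ≤ 1) :
    ∃ (s : ℕ) (C : Fin s → Finset (Fin N × Bool)) (w : Fin s → ℝ),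
      (∀ j, 0 ≤ w j) ∧
      ∀ c : Fin N → Bool,
        (MeasureTheory.volume (⋃ i,
            if c i then Set.Icc (a i) (b i)
            else Set.Icc (a' i) (b' i))).toReal =
          ∑ j ∈ Finset.univ.filter (fun j => ∃ l ∈ C j, c l.1 = l.2), w j := by
  classical
  let I : Fin N × Bool → Set ℝ := fun l =>
    if l.2 then Set.Icc (a l.1) (b l.1) else Set.Icc (a' l.1) (b' l.1)
  have hI : ∀ l, MeasurableSet (I l) := by
    intro l
    simp only [I]
    split_ifs <;> exact measurableSet_Icc
  have hfin : ∀ l, MeasureTheory.volume (I l) ≠ ⊤ := by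
    intro l
    simp only [I]
    split_ifs <;> simp
  let e := (Fintype.equivFin (Finset (Fin N × Bool))).symm
  refine ⟨_, e, fun j => (MeasureTheory.volume (piece I (e j))).toReal,
    fun j => ENNReal.toReal_nonneg, fun c => ?_⟩
  have hU : (⋃ i, if c i then Set.Icc (a i) (b i) else Set.Icc (a' i) (b' i)) =
      ⋃ j ∈ Finset.univ.filter (fun j => ∃ l ∈ e j, c l.1 = l.2), piece I (e j) := by
    ext x
    simp only [Set.mem_iUnion, Finset.mem_filter, Finset.mem_univ, true_and, exists_prop]
    constructor
    · rintro ⟨i, hi⟩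
      refine ⟨e.symm (Finset.univ.filter fun l => x ∈ I l), ⟨(i, c i), ?_, rfl⟩, ?_⟩
      · simpa [I] using hi
      · intro l
        simp
    · rintro ⟨j, ⟨⟨i, t⟩, hl, hc⟩, hx⟩
      have := (hx _).1 hl
      simp only at hc
      subst hc
      exact ⟨i, this⟩
  rw [hU, MeasureTheory.measure_biUnion_finset, ENNReal.toReal_sum]
  · intro j hj
    obtain ⟨l, hl, -⟩ := (Finset.mem_filter.1 hj).2
    exact MeasureTheory.measure_ne_top_of_subset (fun x hx => (hx l).1 hl) (hfin l)
  · intro j _ k _ hjk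
    refine Set.disjoint_left.2 fun x hx hy => hjk (e.injective ?_)
    ext l
    exact (hx l).trans (hy l).symm
  · intro j _
    exact piece_measurable I hI _
end
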